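/- Fix an integer d ≥ 2 and define δ : ℕ → ℕ by δ(n) = nd/2 if n is even and δ(n) = (n−1)d/2 + 1 if n is odd. Let R be an augmented Noetherian semiperfect algebra with Jacobson radical J and let ξ : 0 → K → M → N → 0 be a short exact sequence of finitely generated R-modules in which K, M and N are all quasi-δ-Koszul modules (quasi-d-Koszul modules). Then J·K = K ∩ J·M (identifying K with its image in M) if and only if the minimal Horseshoe Lemma holds for ξ. -/

import Mathlib

/-- `jSMul I K` is the submodule `I·K` generated by the products `r • k`,
`r ∈ I`, `k ∈ K`. -/
def jSMul {R : Type} [Ring R] {M : Type} [AddCommGroup M] [Module R M]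
    (I : Ideal R) (K : Submodule R M) : Submodule R M :=
  Submodule.span R {x : M | ∃ r ∈ I, ∃ k ∈ K, x = r • k}

/-- `jPowSMul I n K` is the submodule `Iⁿ·K`. -/
def jPowSMul {R : Type} [Ring R] {M : Type} [AddCommGroup M] [Module R M]
    (I : Ideal R) : ℕ → Submodule R M → Submodule R M
  | 0, K => K
  | n + 1, K => jSMul I (jPowSMul I n K)

/-- The Jacobson radical of a ring. -/
abbrev jacobsonRad (R : Type) [Ring R] : Ideal R := Ideal.jacobson (⊥ : Ideal R)

/-- A minimal projective resolution `⋯ → P₁ → P₀ → X → 0`. -/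
structure MinProjRes (R : Type) [Ring R] (J : Ideal R)
    (X : Type) [AddCommGroup X] [Module R X] where
  obj : ℕ → Type
  [addcomm : ∀ n, AddCommGroup (obj n)]
  [mod : ∀ n, Module R (obj n)]
  proj : ∀ n, Module.Projective R (obj n)
  fin : ∀ n, Module.Finite R (obj n)
  d : ∀ n, obj (n + 1) →ₗ[R] obj n
  aug : obj 0 →ₗ[R] X
  aug_surj : Function.Surjective aug
  exact0 : LinearMap.range (d 0) = LinearMap.ker aug
  exact : ∀ n, LinearMap.range (d (n + 1)) = LinearMap.ker (d n)
  minimal0 : LinearMap.ker aug ≤ jSMul J ⊤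
  minimal : ∀ n, LinearMap.ker (d n) ≤ jSMul J ⊤

attribute [instance] MinProjRes.addcomm MinProjRes.mod

/-- The syzygies of a minimal projective resolution: `P.syz n ⊆ Pₙ`
is the `(n+1)`-st syzygy `Ω^{n+1}(X) = ker dₙ`. -/
def MinProjRes.syz {R : Type} [Ring R] {J : Ideal R}
    {X : Type} [AddCommGroup X] [Module R X]
    (P : MinProjRes R J X) : ∀ n, Submodule R (P.obj n)
  | 0 => LinearMap.ker P.aug
  | n + 1 => LinearMap.ker (P.d n)

/-- A projective cover of a finitely generated module. -/
structure ProjCover (R : Type) [Ring R] (J : Ideal R)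
    (X : Type) [AddCommGroup X] [Module R X] where
  P : Type
  [addcomm : AddCommGroup P]
  [mod : Module R P]
  p : P →ₗ[R] X
  proj : Module.Projective R P
  fin : Module.Finite R P
  surj : Function.Surjective p
  ker_le : LinearMap.ker p ≤ jSMul J ⊤

attribute [instance] ProjCover.addcomm ProjCover.mod

/-- `R` is semiperfect: every finitely generated module has a projective cover. -/
def Semiperfect (R : Type) [Ring R] : Prop :=
  ∀ (X : Type) [AddCommGroup X] [Module R X], Module.Finite R X →
    Nonempty (ProjCover R (jacobsonRad R) X)

/-- The minimal Horseshoe Lemma holds for the short exact sequence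
`0 → K →f→ M →g→ N → 0`. -/
def MinimalHorseshoe {R : Type} [Ring R] (J : Ideal R)
    {K M N : Type} [AddCommGroup K] [Module R K] [AddCommGroup M] [Module R M]
    [AddCommGroup N] [Module R N] (f : K →ₗ[R] M) (g : M →ₗ[R] N) : Prop :=
  ∃ (P : MinProjRes R J K) (L : MinProjRes R J M) (Q : MinProjRes R J N)
    (φ : ∀ n, P.obj n →ₗ[R] L.obj n) (ψ : ∀ n, L.obj n →ₗ[R] Q.obj n),
    L.aug ∘ₗ φ 0 = f ∘ₗ P.aug ∧
    Q.aug ∘ₗ ψ 0 = g ∘ₗ L.aug ∧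
    (∀ n, L.d n ∘ₗ φ (n + 1) = φ n ∘ₗ P.d n) ∧
    (∀ n, Q.d n ∘ₗ ψ (n + 1) = ψ n ∘ₗ L.d n) ∧
    (∀ n, Function.Injective (φ n)) ∧
    (∀ n, Function.Surjective (ψ n)) ∧
    (∀ n, LinearMap.ker (ψ n) = LinearMap.range (φ n))

/-- `X` is a quasi-`δ`-Koszul module. -/
def IsQuasiDeltaKoszul {R : Type} [Ring R] (J : Ideal R) (δ : ℕ → ℕ)
    (X : Type) [AddCommGroup X] [Module R X] : Prop :=
  ∃ P : MinProjRes R J X, ∀ n,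
    P.syz n ≤ jPowSMul J (δ (n + 1) - δ n) ⊤ ∧
    jSMul J (P.syz n) = P.syz n ⊓ jPowSMul J (δ (n + 1) - δ n + 1) ⊤

/-- `X` is a quasi-Koszul module. -/
def IsQuasiKoszul {R : Type} [Ring R] (J : Ideal R)
    (X : Type) [AddCommGroup X] [Module R X] : Prop :=
  ∃ P : MinProjRes R J X, ∀ n,
    jSMul J (P.syz n) = P.syz n ⊓ jPowSMul J 2 ⊤

section JSMul

variable {R : Type} [Ring R] {M N : Type} [AddCommGroup M] [Module R M]
  [AddCommGroup N] [Module R N] (I : Ideal R)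

theorem jSMul_mono {A B : Submodule R M} (h : A ≤ B) : jSMul I A ≤ jSMul I B :=
  Submodule.span_mono fun _ ⟨r, hr, m, hm, hx⟩ ↦ ⟨r, hr, m, h hm, hx⟩

theorem map_jSMul (f : M →ₗ[R] N) (A : Submodule R M) :
    (jSMul I A).map f = jSMul I (A.map f) := by
  rw [jSMul, Submodule.map_span]
  congr 1
  ext x
  constructor
  · rintro ⟨_, ⟨r, hr, m, hm, rfl⟩, rfl⟩
    exact ⟨r, hr, f m, ⟨m, hm, rfl⟩, map_smul f r m⟩
  · rintro ⟨r, hr, _, ⟨m, hm, rfl⟩, rfl⟩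
    exact ⟨r • m, ⟨r, hr, m, hm, rfl⟩, map_smul f r m⟩

theorem map_jPowSMul (f : M →ₗ[R] N) (n : ℕ) (A : Submodule R M) :
    (jPowSMul I n A).map f = jPowSMul I n (A.map f) := by
  induction n with
  | zero => rfl
  | succ n ih => rw [jPowSMul, map_jSMul, ih, jPowSMul]

theorem jPowSMul_mono (n : ℕ) {A B : Submodule R M} (h : A ≤ B) :
    jPowSMul I n A ≤ jPowSMul I n B := by
  induction n with
  | zero => exact h
  | succ n ih => exact jSMul_mono I ih

theorem map_mem_jPowSMul_top (f : M →ₗ[R] N) (n : ℕ) {x : M} (hx : x ∈ jPowSMul I n ⊤) :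
    f x ∈ jPowSMul I n (⊤ : Submodule R N) :=
  jPowSMul_mono I n le_top (map_jPowSMul I f n ⊤ ▸ Submodule.mem_map_of_mem hx)

theorem map_mem_jSMul_top (f : M →ₗ[R] N) {x : M} (hx : x ∈ jSMul I ⊤) :
    f x ∈ jSMul I (⊤ : Submodule R N) :=
  map_mem_jPowSMul_top I f 1 hx

theorem mem_jSMul_top_iff {A : Submodule R M} (x : A) :
    x ∈ jSMul I (⊤ : Submodule R A) ↔ (x : M) ∈ jSMul I A := by
  have h := map_jSMul I A.subtype ⊤
  rw [Submodule.map_top, Submodule.range_subtype] at h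
  rw [← h]
  simp

variable {I}

/-- Nakayama's lemma for `jSMul`. -/
theorem eq_top_of_sup_jSMul_eq_top (hI : I ≤ jacobsonRad R) [Module.Finite R M]
    {A : Submodule R M} (h : A ⊔ jSMul I ⊤ = ⊤) : A = ⊤ := by
  by_contra hA
  obtain ⟨m, hm, hle⟩ := (eq_top_or_exists_le_coatom A).resolve_left hA
  have hJ : jSMul I (⊤ : Submodule R M) ≤ m := by
    refine le_trans ?_ (sInf_le hm : Module.jacobson R M ≤ m)
    refine Submodule.span_le.mpr ?_
    rintro _ ⟨r, hr, x, -, rfl⟩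
    refine Ring.jacobson_smul_top_le R M (Submodule.smul_mem_smul ?_ Submodule.mem_top)
    have := hI hr
    rwa [jacobsonRad, Ideal.jacobson_bot] at this
  exact hm.1 (top_le_iff.mp (h ▸ sup_le hle hJ))

end JSMul

section Cover

variable {R : Type} [Ring R] {I : Ideal R}

/-- The surjections whose kernel lies in `I` times the source. -/
structure IsMinimalCover (I : Ideal R) {P X : Type} [AddCommGroup P] [Module R P]
    [AddCommGroup X] [Module R X] (p : P →ₗ[R] X) : Prop where
  surj : Function.Surjective p
  ker_le : LinearMap.ker p ≤ jSMul I ⊤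

variable {P P' X : Type} [AddCommGroup P] [Module R P] [AddCommGroup P'] [Module R P']
  [AddCommGroup X] [Module R X] {p : P →ₗ[R] X} {p' : P' →ₗ[R] X}

theorem IsMinimalCover.mem_of_map_mem (hp : IsMinimalCover I p) {x : P}
    (hx : p x ∈ jSMul I (⊤ : Submodule R X)) : x ∈ jSMul I (⊤ : Submodule R P) := by
  have h := map_jSMul I p ⊤
  rw [Submodule.map_top, LinearMap.range_eq_top.mpr hp.surj] at h
  rw [← h] at hx
  obtain ⟨y, hy, hxy⟩ := hx
  rw [← sub_add_cancel x y]
  exact add_mem (hp.ker_le (by simp [hxy])) hy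

theorem IsMinimalCover.surjective_of_comp_eq (hI : I ≤ jacobsonRad R) [Module.Finite R P']
    (hp : Function.Surjective p) (hp' : IsMinimalCover I p') (s : P →ₗ[R] P')
    (hs : p' ∘ₗ s = p) : Function.Surjective s := by
  rw [← LinearMap.range_eq_top]
  refine eq_top_of_sup_jSMul_eq_top hI (top_le_iff.mp fun y _ ↦ ?_)
  obtain ⟨x, hx⟩ := hp (p' y)
  rw [← add_sub_cancel (s x) y]
  refine add_mem (Submodule.mem_sup_left ⟨x, rfl⟩) (Submodule.mem_sup_right (hp'.ker_le ?_))
  rw [LinearMap.mem_ker, map_sub, ← hx, ← hs, LinearMap.comp_apply, sub_self]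

/-- Uniqueness of projective covers. -/
theorem IsMinimalCover.exists_equiv (hI : I ≤ jacobsonRad R) [Module.Finite R P]
    [Module.Finite R P'] [Module.Projective R P] [Module.Projective R P']
    (hp : IsMinimalCover I p) (hp' : IsMinimalCover I p') :
    ∃ e : P ≃ₗ[R] P', p' ∘ₗ e.toLinearMap = p := by
  obtain ⟨s, hs⟩ := Module.projective_lifting_property p' p hp'.surj
  have hsurj := IsMinimalCover.surjective_of_comp_eq hI hp.surj hp' s hs
  obtain ⟨t, ht⟩ := Module.projective_lifting_property s LinearMap.id hsurj
  have htsurj : Function.Surjective t := by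
    refine IsMinimalCover.surjective_of_comp_eq hI hp'.surj hp t ?_
    rw [← hs, LinearMap.comp_assoc, ht, LinearMap.comp_id]
  have hinj : Function.Injective s := by
    intro a b hab
    obtain ⟨a, rfl⟩ := htsurj a
    obtain ⟨b, rfl⟩ := htsurj b
    have h (x) : s (t x) = x := LinearMap.congr_fun ht x
    rw [h, h] at hab
    rw [hab]
  exact ⟨LinearEquiv.ofBijective s ⟨hinj, hsurj⟩, hs⟩

end Cover

section Step

variable {R : Type} [Ring R] {I : Ideal R}
  {P L Q : Type} [AddCommGroup P] [Module R P] [AddCommGroup L] [Module R L]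
  [AddCommGroup Q] [Module R Q]

/-- A short exact sequence `0 → K → M → N → 0` with `I·K = K ∩ I·M`. -/
structure IsStrictExact (I : Ideal R) (φ : P →ₗ[R] L) (ψ : L →ₗ[R] Q) : Prop where
  inj : Function.Injective φ
  surj : Function.Surjective ψ
  exact : LinearMap.ker ψ = LinearMap.range φ
  strict : ∀ x, φ x ∈ jSMul I (⊤ : Submodule R L) → x ∈ jSMul I (⊤ : Submodule R P)

theorem IsStrictExact.apply_apply {φ : P →ₗ[R] L} {ψ : L →ₗ[R] Q}
    (h : IsStrictExact I φ ψ) (x : P) : ψ (φ x) = 0 :=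
  h.exact.ge ⟨x, rfl⟩

variable {K M N : Type} [AddCommGroup K] [Module R K] [AddCommGroup M] [Module R M]
  [AddCommGroup N] [Module R N] {f : K →ₗ[R] M} {g : M →ₗ[R] N}
  {p : P →ₗ[R] K} {l : L →ₗ[R] M} {q : Q →ₗ[R] N}

/-- The horseshoe over a strict exact sequence is a projective cover. -/
theorem IsStrictExact.exists_lift (hI : I ≤ jacobsonRad R) [Module.Finite R P]
    [Module.Finite R L] [Module.Finite R Q] [Module.Projective R P] [Module.Projective R L]
    [Module.Projective R Q] (h : IsStrictExact I f g) (hp : IsMinimalCover I p)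
    (hl : IsMinimalCover I l) (hq : IsMinimalCover I q) :
    ∃ (φ : P →ₗ[R] L) (ψ : L →ₗ[R] Q), l ∘ₗ φ = f ∘ₗ p ∧ q ∘ₗ ψ = g ∘ₗ l ∧
      Function.Injective φ ∧ Function.Surjective ψ ∧ LinearMap.ker ψ = LinearMap.range φ := by
  obtain ⟨t, ht⟩ := Module.projective_lifting_property g q h.surj
  have ht' (x) : g (t x) = q x := LinearMap.congr_fun ht x
  have hc : IsMinimalCover I ((f ∘ₗ p).coprod t) := by
    constructor
    · intro m
      obtain ⟨y, hy⟩ := hq.surj (g m)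
      obtain ⟨x, hx⟩ : m - t y ∈ LinearMap.range f := by
        rw [← h.exact, LinearMap.mem_ker, map_sub, ht', hy, sub_self]
      obtain ⟨x, rfl⟩ := hp.surj x
      exact ⟨(x, y), by simp [hx]⟩
    · rintro ⟨x, y⟩ hxy
      replace hxy : f (p x) + t y = 0 := by simpa using hxy
      have hy : y ∈ jSMul I (⊤ : Submodule R Q) := by
        refine hq.ker_le ?_
        have := congrArg g hxy
        rwa [map_add, h.apply_apply, zero_add, map_zero, ht'] at this
      have hx : x ∈ jSMul I (⊤ : Submodule R P) := by
        refine hp.mem_of_map_mem (h.strict _ ?_)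
        rw [eq_neg_of_add_eq_zero_left hxy]
        exact neg_mem (map_mem_jSMul_top I t hy)
      have := add_mem (map_mem_jSMul_top I (LinearMap.inl R P Q) hx)
        (map_mem_jSMul_top I (LinearMap.inr R P Q) hy)
      simpa using this
  obtain ⟨e, he⟩ := hc.exists_equiv hI hl
  have he' (z) : l (e z) = f (p z.1) + t z.2 := by
    simpa using LinearMap.congr_fun he z
  refine ⟨e.toLinearMap ∘ₗ LinearMap.inl R P Q, LinearMap.snd R P Q ∘ₗ e.symm.toLinearMap,
    ?_, ?_, ?_, ?_, ?_⟩
  · ext x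
    simp [he']
  · ext y
    obtain ⟨z, rfl⟩ := e.surjective y
    simp [he', ht', h.apply_apply]
  · exact e.injective.comp LinearMap.inl_injective
  · exact (LinearMap.snd_surjective (R := R) (M := P)).comp e.symm.surjective
  · ext y
    obtain ⟨⟨x, z⟩, rfl⟩ := e.surjective y
    simp [eq_comm]

theorem exists_retraction [Module.Projective R Q] {φ : P →ₗ[R] L} {ψ : L →ₗ[R] Q}
    (hφ : Function.Injective φ) (hψ : Function.Surjective ψ)
    (he : LinearMap.ker ψ = LinearMap.range φ) : ∃ r : L →ₗ[R] P, r ∘ₗ φ = LinearMap.id := by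
  have hex : Function.Exact φ ψ := LinearMap.exact_iff.mpr he
  have h := (Function.Exact.split_tfae' hex).out 0 1
  exact (h.mp ⟨hφ, Module.projective_lifting_property ψ LinearMap.id hψ⟩).2

/-- Maps of covers which are strict exact on the submodules `A`, `B`, `C`. -/
structure IsSyzygyExact (I : Ideal R) (φ : P →ₗ[R] L) (ψ : L →ₗ[R] Q)
    (A : Submodule R P) (B : Submodule R L) (C : Submodule R Q) : Prop where
  inj : Function.Injective φ
  surj : Function.Surjective ψ
  exact : LinearMap.ker ψ = LinearMap.range φ
  restrict : ∃ (hφ : ∀ x ∈ A, φ x ∈ B) (hψ : ∀ y ∈ B, ψ y ∈ C),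
    IsStrictExact I (φ.restrict hφ) (ψ.restrict hψ)

/-- One step of the minimal Horseshoe Lemma. -/
theorem IsStrictExact.exists_isSyzygyExact (hI : I ≤ jacobsonRad R) [Module.Finite R P]
    [Module.Finite R L] [Module.Finite R Q] [Module.Projective R P] [Module.Projective R L]
    [Module.Projective R Q] (h : IsStrictExact I f g) (hp : IsMinimalCover I p)
    (hl : IsMinimalCover I l) (hq : IsMinimalCover I q) (a : ℕ)
    (hla : LinearMap.ker l ≤ jPowSMul I a ⊤)
    (hpa : jSMul I (LinearMap.ker p) = LinearMap.ker p ⊓ jPowSMul I (a + 1) ⊤) :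
    ∃ (φ : P →ₗ[R] L) (ψ : L →ₗ[R] Q), l ∘ₗ φ = f ∘ₗ p ∧ q ∘ₗ ψ = g ∘ₗ l ∧
      IsSyzygyExact I φ ψ (LinearMap.ker p) (LinearMap.ker l) (LinearMap.ker q) := by
  obtain ⟨φ, ψ, hφ, hψ, inj, surj, exact⟩ := h.exists_lift hI hp hl hq
  have hφ' (x) : l (φ x) = f (p x) := LinearMap.congr_fun hφ x
  have hψ' (x) : q (ψ x) = g (l x) := LinearMap.congr_fun hψ x
  have hleft : ∀ x ∈ LinearMap.ker p, φ x ∈ LinearMap.ker l := by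
    intro x hx
    rw [LinearMap.mem_ker] at hx ⊢
    rw [hφ', hx, map_zero]
  have hright : ∀ y ∈ LinearMap.ker l, ψ y ∈ LinearMap.ker q := by
    intro y hy
    rw [LinearMap.mem_ker] at hy ⊢
    rw [hψ', hy, map_zero]
  have hψφ (x) : ψ (φ x) = 0 := exact.ge ⟨x, rfl⟩
  refine ⟨φ, ψ, hφ, hψ, inj, surj, exact, hleft, hright, ?_, ?_, ?_, ?_⟩
  · exact fun x y hxy ↦ Subtype.ext (inj (congrArg Subtype.val hxy))
  · rintro ⟨z, hz⟩
    obtain ⟨y, rfl⟩ := surj z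
    obtain ⟨x, hx⟩ : l y ∈ LinearMap.range f := by
      rw [← h.exact, LinearMap.mem_ker, ← hψ']
      exact hz
    obtain ⟨x, rfl⟩ := hp.surj x
    refine ⟨⟨y - φ x, ?_⟩, Subtype.ext ?_⟩
    · rw [LinearMap.mem_ker, map_sub, hφ', hx, sub_self]
    · simp [hψφ]
  · ext ⟨y, hy⟩
    constructor
    · intro hz
      obtain ⟨x, rfl⟩ : y ∈ LinearMap.range φ := exact.le (congrArg Subtype.val hz)
      refine ⟨⟨x, h.inj ?_⟩, rfl⟩
      rw [← hφ', map_zero]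
      exact hy
    · rintro ⟨x, hx⟩
      refine Subtype.ext ?_
      rw [← hx]
      exact hψφ x
  · rintro ⟨x, hx⟩ hmem
    rw [mem_jSMul_top_iff] at hmem ⊢
    rw [hpa]
    refine ⟨hx, ?_⟩
    obtain ⟨r, hr⟩ := exists_retraction inj surj exact
    have hmem' : φ x ∈ jPowSMul I (a + 1) (⊤ : Submodule R L) := jSMul_mono I hla hmem
    have := map_mem_jPowSMul_top I r (a + 1) hmem'
    rwa [show r (φ x) = x from LinearMap.congr_fun hr x] at this

end Step

namespace MinProjRes

variable {R : Type} [Ring R] {J : Ideal R}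

attribute [instance] MinProjRes.proj MinProjRes.fin

section

variable {X : Type} [AddCommGroup X] [Module R X] (P : MinProjRes R J X)

theorem range_d : ∀ n, LinearMap.range (P.d n) = P.syz n
  | 0 => P.exact0
  | n + 1 => P.exact n

/-- The differential as a map onto the syzygy. -/
def toSyz (n : ℕ) : P.obj (n + 1) →ₗ[R] P.syz n :=
  (P.d n).codRestrict (P.syz n) fun x ↦ P.range_d n ▸ ⟨x, rfl⟩

theorem ker_toSyz (n : ℕ) : LinearMap.ker (P.toSyz n) = P.syz (n + 1) :=
  LinearMap.ker_codRestrict _ _ _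

theorem isMinimalCover_aug : IsMinimalCover J P.aug := ⟨P.aug_surj, P.minimal0⟩

theorem isMinimalCover_toSyz (n : ℕ) : IsMinimalCover J (P.toSyz n) := by
  refine ⟨?_, (P.ker_toSyz n).trans_le (P.minimal n)⟩
  rintro ⟨x, hx⟩
  rw [← P.range_d n] at hx
  obtain ⟨y, hy⟩ := hx
  exact ⟨y, Subtype.ext hy⟩

end

variable {K M N : Type} [AddCommGroup K] [Module R K] [AddCommGroup M] [Module R M]
  [AddCommGroup N] [Module R N] (P : MinProjRes R J K) (L : MinProjRes R J M)
  (Q : MinProjRes R J N)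

/-- Degree `n` of a horseshoe on the resolutions `P`, `L`, `Q`. -/
abbrev HorseshoeAt (n : ℕ) : Type :=
  {c : (P.obj n →ₗ[R] L.obj n) × (L.obj n →ₗ[R] Q.obj n) //
    IsSyzygyExact J c.1 c.2 (P.syz n) (L.syz n) (Q.syz n)}

variable {P L Q}

theorem exists_horseshoeAt_succ (hJ : J ≤ jacobsonRad R) {a : ℕ → ℕ}
    (hL : ∀ n, L.syz n ≤ jPowSMul J (a n) ⊤)
    (hP : ∀ n, jSMul J (P.syz n) = P.syz n ⊓ jPowSMul J (a n + 1) ⊤)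
    {n : ℕ} (c : HorseshoeAt P L Q n) :
    ∃ c' : HorseshoeAt P L Q (n + 1),
      L.d n ∘ₗ c'.1.1 = c.1.1 ∘ₗ P.d n ∧ Q.d n ∘ₗ c'.1.2 = c.1.2 ∘ₗ L.d n := by
  obtain ⟨hφ, hψ, h⟩ := c.2.restrict
  obtain ⟨φ, ψ, h1, h2, h3⟩ := h.exists_isSyzygyExact hJ (P.isMinimalCover_toSyz n)
    (L.isMinimalCover_toSyz n) (Q.isMinimalCover_toSyz n) (a (n + 1))
    ((L.ker_toSyz n).trans_le (hL (n + 1))) (P.ker_toSyz n ▸ hP (n + 1))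
  rw [P.ker_toSyz, L.ker_toSyz, Q.ker_toSyz] at h3
  refine ⟨⟨(φ, ψ), h3⟩, ?_, ?_⟩
  · ext x
    exact congrArg Subtype.val (LinearMap.congr_fun h1 x)
  · ext x
    exact congrArg Subtype.val (LinearMap.congr_fun h2 x)

end MinProjRes

theorem IsStrictExact.minimalHorseshoe {R : Type} [Ring R] {J : Ideal R}
    (hJ : J ≤ jacobsonRad R) {K M N : Type} [AddCommGroup K] [Module R K]
    [AddCommGroup M] [Module R M] [AddCommGroup N] [Module R N] {f : K →ₗ[R] M}
    {g : M →ₗ[R] N} (h : IsStrictExact J f g) (P : MinProjRes R J K) (L : MinProjRes R J M)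
    (Q : MinProjRes R J N) {a : ℕ → ℕ} (hL : ∀ n, L.syz n ≤ jPowSMul J (a n) ⊤)
    (hP : ∀ n, jSMul J (P.syz n) = P.syz n ⊓ jPowSMul J (a n + 1) ⊤) :
    MinimalHorseshoe J f g := by
  obtain ⟨φ, ψ, h1, h2, h3⟩ := h.exists_isSyzygyExact hJ P.isMinimalCover_aug
    L.isMinimalCover_aug Q.isMinimalCover_aug (a 0) (hL 0) (hP 0)
  choose next hnext using
    fun n (c : MinProjRes.HorseshoeAt P L Q n) ↦ MinProjRes.exists_horseshoeAt_succ hJ hL hP c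
  let c : ∀ n, MinProjRes.HorseshoeAt P L Q n :=
    fun n ↦ Nat.rec ⟨(φ, ψ), h3⟩ (fun n c ↦ next n c) n
  exact ⟨P, L, Q, fun n ↦ (c n).1.1, fun n ↦ (c n).1.2, h1, h2, fun n ↦ (hnext n (c n)).1,
    fun n ↦ (hnext n (c n)).2, fun n ↦ (c n).2.inj, fun n ↦ (c n).2.surj,
    fun n ↦ (c n).2.exact⟩

theorem MinimalHorseshoe.mem_jSMul_top {R : Type} [Ring R] {J : Ideal R}
    {K M N : Type} [AddCommGroup K] [Module R K]
    [AddCommGroup M] [Module R M] [AddCommGroup N] [Module R N] {f : K →ₗ[R] M}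
    {g : M →ₗ[R] N} (h : MinimalHorseshoe J f g) {x : K}
    (hx : f x ∈ jSMul J (⊤ : Submodule R M)) : x ∈ jSMul J (⊤ : Submodule R K) := by
  obtain ⟨P, L, Q, φ, ψ, h1, -, -, -, hinj, hsurj, hex⟩ := h
  obtain ⟨r, hr⟩ := exists_retraction (hinj 0) (hsurj 0) (hex 0)
  obtain ⟨y, rfl⟩ := P.aug_surj x
  refine map_mem_jSMul_top J P.aug ?_
  rw [← show r (φ 0 y) = y from LinearMap.congr_fun hr y]
  refine map_mem_jSMul_top J r (L.isMinimalCover_aug.mem_of_map_mem ?_)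
  rwa [show L.aug (φ 0 y) = f (P.aug y) from LinearMap.congr_fun h1 y]

/-- Corollary B(2): the quasi-`d`-Koszul case, where
`δ(n) = nd/2` for even `n` and `δ(n) = (n-1)d/2 + 1` for odd `n`. -/
theorem quasiDKoszul_jsmul_iff_minimalHorseshoe
    (d : ℕ) (hd : 2 ≤ d)
    {k : Type} [Field k] {R : Type} [Ring R] [Algebra k R] (ε : R →ₐ[k] k)
    [IsNoetherianRing R] (hsp : Semiperfect R) (J : Ideal R)
    (hJ : J = jacobsonRad R)
    (δ : ℕ → ℕ)
    (hδ : ∀ n, δ n = if Even n then n * d / 2 else (n - 1) * d / 2 + 1)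
    {K M N : Type} [AddCommGroup K] [Module R K] [AddCommGroup M] [Module R M]
    [AddCommGroup N] [Module R N]
    [Module.Finite R K] [Module.Finite R M] [Module.Finite R N]
    (f : K →ₗ[R] M) (g : M →ₗ[R] N)
    (hf : Function.Injective f) (hg : Function.Surjective g)
    (hfg : LinearMap.range f = LinearMap.ker g)
    (hK : IsQuasiDeltaKoszul J δ K) (hM : IsQuasiDeltaKoszul J δ M)
    (hN : IsQuasiDeltaKoszul J δ N) :
    Submodule.map f (jSMul J (⊤ : Submodule R K)) =
      LinearMap.range f ⊓ jSMul J (⊤ : Submodule R M) ↔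
    MinimalHorseshoe J f g := by
  constructor
  · intro h
    obtain ⟨P, hP⟩ := hK
    obtain ⟨L, hL⟩ := hM
    obtain ⟨Q, -⟩ := hN
    have hs : IsStrictExact J f g := by
      refine ⟨hf, hg, hfg.symm, fun x hx ↦ ?_⟩
      obtain ⟨y, hy, hyx⟩ := h.ge ⟨⟨x, rfl⟩, hx⟩
      exact hf hyx ▸ hy
    exact hs.minimalHorseshoe hJ.le P L Q (fun n ↦ (hL n).1) fun n ↦ (hP n).2
  · intro h
    refine le_antisymm (le_inf LinearMap.map_le_range ?_) ?_
    · rintro _ ⟨x, hx, rfl⟩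
      exact map_mem_jSMul_top J f hx
    · rintro _ ⟨⟨x, rfl⟩, hx⟩
      exact ⟨x, h.mem_jSMul_top hx, rfl⟩
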